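/- For every l ∈ ℕ, the third mixed derivative of P_l ∘ h along V^⊥ once in the x-variables and along V twice in the y-variables, evaluated on the diagonal, satisfies V_x^⊥ V_y V_y P_l(h)|_{x=y} = ã₃₄(θ, φ) P_l'(1), where ã₃₄(θ, φ) = v₂ v₁ (∂v₁/∂θ) sin²φ + 2 v₂² v₁ sinφ cosφ + v₂² (∂v₁/∂φ) sin²φ + v₁³ cosφ sin³φ − v₁² (∂v₂/∂θ) sin²φ − v₁ v₂ (∂v₂/∂φ) sin²φ, with all functions evaluated at (θ, φ). -/

import Mathlib

open Real

/-- The degree-`l` Legendre polynomial, via the Rodrigues formula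
`P_l(t) = 1/(2^l l!) dˡ/dtˡ (t² − 1)ˡ`. -/
noncomputable def legP (l : ℕ) : ℝ → ℝ :=
  fun t => (1 / (2 ^ l * (Nat.factorial l : ℝ))) * iteratedDeriv l (fun s => (s ^ 2 - 1) ^ l) t

/-- `h(θ_x, φ_x, θ_y, φ_y)`, the cosine of the spherical distance. -/
noncomputable def sphH (θx φx θy φy : ℝ) : ℝ :=
  Real.cos φx * Real.cos φy + Real.sin φx * Real.sin φy * Real.cos (θx - θy)

/-- Functions of the four variables `(θ_x, φ_x, θ_y, φ_y)`. -/
abbrev F4 : Type := ℝ → ℝ → ℝ → ℝ → ℝ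

/-- `∂/∂θ_x`. -/
noncomputable def pθx (f : F4) : F4 := fun a b c d => deriv (fun t => f t b c d) a
/-- `∂/∂φ_x`. -/
noncomputable def pφx (f : F4) : F4 := fun a b c d => deriv (fun t => f a t c d) b
/-- `∂/∂θ_y`. -/
noncomputable def pθy (f : F4) : F4 := fun a b c d => deriv (fun t => f a b t d) c
/-- `∂/∂φ_y`. -/
noncomputable def pφy (f : F4) : F4 := fun a b c d => deriv (fun t => f a b c t) d

/-- The operator `V_x = v₁(θ_x,φ_x) ∂/∂θ_x + v₂(θ_x,φ_x) ∂/∂φ_x`. -/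
noncomputable def Vx (v₁ v₂ : ℝ → ℝ → ℝ) (f : F4) : F4 :=
  fun a b c d => v₁ a b * pθx f a b c d + v₂ a b * pφx f a b c d

/-- The operator `V_y = v₁(θ_y,φ_y) ∂/∂θ_y + v₂(θ_y,φ_y) ∂/∂φ_y`. -/
noncomputable def Vy (v₁ v₂ : ℝ → ℝ → ℝ) (f : F4) : F4 :=
  fun a b c d => v₁ c d * pθy f a b c d + v₂ c d * pφy f a b c d

/-- The operator `V_x^⊥ = v₂(θ_x,φ_x) ∂/∂θ_x − sin²(φ_x) v₁(θ_x,φ_x) ∂/∂φ_x`. -/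
noncomputable def Vxp (v₁ v₂ : ℝ → ℝ → ℝ) (f : F4) : F4 :=
  fun a b c d => v₂ a b * pθx f a b c d - (Real.sin b) ^ 2 * v₁ a b * pφx f a b c d

/-- The operator `V_y^⊥ = v₂(θ_y,φ_y) ∂/∂θ_y − sin²(φ_y) v₁(θ_y,φ_y) ∂/∂φ_y`. -/
noncomputable def Vyp (v₁ v₂ : ℝ → ℝ → ℝ) (f : F4) : F4 :=
  fun a b c d => v₂ c d * pθy f a b c d - (Real.sin d) ^ 2 * v₁ c d * pφy f a b c d

/-- `P_l ∘ h` as a function of the four variables. -/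
noncomputable def PH (l : ℕ) : F4 := fun a b c d => legP l (sphH a b c d)

open scoped ContDiff

lemma contDiff_legP (l : ℕ) : ContDiff ℝ ∞ (legP l) := by
  unfold legP
  have h : ContDiff ℝ ∞ (fun s : ℝ => (s ^ 2 - 1) ^ l) := by fun_prop
  refine contDiff_const.mul ?_
  rw [iteratedDeriv_eq_iterate]
  exact h.iterate_deriv l

/-- `V_y h`, with the coefficients frozen as the numbers `p` and `q`. -/
noncomputable def sphHDir (p q a b c d : ℝ) : ℝ :=
  p * (sin b * sin d * sin (a - c)) + q * (-(cos b * sin d) + sin b * cos d * cos (a - c))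

/-- `V_y V_y h`, with the coefficients `p`, `q` of the field and the derivatives `r`, `s` of its
components along itself frozen as numbers. -/
noncomputable def sphHDirTwo (p q r s a b c d : ℝ) : ℝ :=
  sphHDir r s a b c d - p ^ 2 * (sin b * sin d * cos (a - c)) +
    2 * p * q * (sin b * cos d * sin (a - c)) - q ^ 2 * sphH a b c d

lemma hasDerivAt_sphH_θx (a b c d : ℝ) :
    HasDerivAt (fun t => sphH t b c d) (-(sin b * sin d * sin (a - c))) a := by
  unfold sphH
  refine (((((hasDerivAt_id a).sub_const c).cos).const_mul (sin b * sin d)).const_add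
    (cos b * cos d)).congr_deriv ?_
  simp

lemma hasDerivAt_sphH_φx (a b c d : ℝ) :
    HasDerivAt (fun t => sphH a t c d) (-(sin b * cos d) + cos b * sin d * cos (a - c)) b := by
  unfold sphH
  refine (((hasDerivAt_cos b).mul_const _).add
    (((hasDerivAt_sin b).mul_const _).mul_const _)).congr_deriv ?_
  ring

lemma hasDerivAt_sphH_θy (a b c d : ℝ) :
    HasDerivAt (fun t => sphH a b t d) (sin b * sin d * sin (a - c)) c := by
  unfold sphH
  refine (((((hasDerivAt_id c).const_sub a).cos).const_mul (sin b * sin d)).const_add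
    (cos b * cos d)).congr_deriv ?_
  simp

lemma hasDerivAt_sphH_φy (a b c d : ℝ) :
    HasDerivAt (fun t => sphH a b c t) (-(cos b * sin d) + sin b * cos d * cos (a - c)) d := by
  unfold sphH
  refine (((hasDerivAt_cos d).const_mul (cos b)).add
    (((hasDerivAt_sin d).const_mul (sin b)).mul_const _)).congr_deriv ?_
  ring

lemma hasDerivAt_sphHDir_θx (p q a b c d : ℝ) :
    HasDerivAt (fun t => sphHDir p q t b c d)
      (p * (sin b * sin d * cos (a - c)) - q * (sin b * cos d * sin (a - c))) a := by
  unfold sphHDir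
  have h := (hasDerivAt_id a).sub_const c
  refine (((h.sin.const_mul (sin b * sin d)).const_mul p).add
    (((h.cos.const_mul (sin b * cos d)).const_add (-(cos b * sin d))).const_mul q)).congr_deriv ?_
  simp only [id]
  ring

lemma hasDerivAt_sphHDir_φx (p q a b c d : ℝ) :
    HasDerivAt (fun t => sphHDir p q a t c d)
      (p * (cos b * sin d * sin (a - c)) +
        q * (sin b * sin d + cos b * cos d * cos (a - c))) b := by
  unfold sphHDir
  refine (((((hasDerivAt_sin b).mul_const _).mul_const _).const_mul p).add
    ((((hasDerivAt_cos b).mul_const _).neg.add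
      (((hasDerivAt_sin b).mul_const _).mul_const _)).const_mul q)).congr_deriv ?_
  ring

lemma hasDerivAt_sphHDir_θy {p q : ℝ → ℝ} {p' q' c : ℝ} (hp : HasDerivAt p p' c)
    (hq : HasDerivAt q q' c) (a b d : ℝ) :
    HasDerivAt (fun t => sphHDir (p t) (q t) a b t d)
      (sphHDir p' q' a b c d - p c * (sin b * sin d * cos (a - c)) +
        q c * (sin b * cos d * sin (a - c))) c := by
  unfold sphHDir
  have h := (hasDerivAt_id c).const_sub a
  refine ((hp.mul (h.sin.const_mul (sin b * sin d))).add
    (hq.mul ((h.cos.const_mul (sin b * cos d)).const_add (-(cos b * sin d))))).congr_deriv ?_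
  simp only [id]
  ring

lemma hasDerivAt_sphHDir_φy {p q : ℝ → ℝ} {p' q' d : ℝ} (hp : HasDerivAt p p' d)
    (hq : HasDerivAt q q' d) (a b c : ℝ) :
    HasDerivAt (fun t => sphHDir (p t) (q t) a b c t)
      (sphHDir p' q' a b c d + p d * (sin b * cos d * sin (a - c)) - q d * sphH a b c d) d := by
  unfold sphHDir sphH
  refine ((hp.mul (((hasDerivAt_sin d).const_mul (sin b)).mul_const _)).add
    (hq.mul (((hasDerivAt_sin d).const_mul (cos b)).fun_neg.fun_add
      (((hasDerivAt_cos d).const_mul (sin b)).mul_const _)))).congr_deriv ?_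
  ring

lemma Vy_comp_sphH (v₁ v₂ : ℝ → ℝ → ℝ) {f : ℝ → ℝ} (hf : Differentiable ℝ f) :
    Vy v₁ v₂ (fun a b c d => f (sphH a b c d)) =
      fun a b c d => deriv f (sphH a b c d) * sphHDir (v₁ c d) (v₂ c d) a b c d := by
  funext a b c d
  have h₁ := ((hf (sphH a b c d)).hasDerivAt.comp c (hasDerivAt_sphH_θy a b c d)).deriv
  have h₂ := ((hf (sphH a b c d)).hasDerivAt.comp d (hasDerivAt_sphH_φy a b c d)).deriv
  simp only [Function.comp_def] at h₁ h₂
  simp only [Vy, pθy, pφy, h₁, h₂, sphHDir]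
  ring

lemma Vy_mul_sphHDir {v₁ v₂ : ℝ → ℝ → ℝ} (hv₁ : Differentiable ℝ (Function.uncurry v₁))
    (hv₂ : Differentiable ℝ (Function.uncurry v₂)) {g : ℝ → ℝ} (hg : Differentiable ℝ g) :
    Vy v₁ v₂ (fun a b c d => g (sphH a b c d) * sphHDir (v₁ c d) (v₂ c d) a b c d) =
      fun a b c d => deriv g (sphH a b c d) * sphHDir (v₁ c d) (v₂ c d) a b c d ^ 2 +
        g (sphH a b c d) * sphHDirTwo (v₁ c d) (v₂ c d)
          (v₁ c d * deriv (fun t => v₁ t d) c + v₂ c d * deriv (fun t => v₁ c t) d)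
          (v₁ c d * deriv (fun t => v₂ t d) c + v₂ c d * deriv (fun t => v₂ c t) d) a b c d := by
  funext a b c d
  have hθ {v : ℝ → ℝ → ℝ} (hv : Differentiable ℝ (Function.uncurry v)) :
      HasDerivAt (fun t => v t d) (deriv (fun t => v t d) c) c :=
    DifferentiableAt.hasDerivAt <| (hv (c, d)).comp c
      (f := fun t => (t, d)) (differentiableAt_id.prodMk (differentiableAt_const d))
  have hφ {v : ℝ → ℝ → ℝ} (hv : Differentiable ℝ (Function.uncurry v)) :
      HasDerivAt (fun t => v c t) (deriv (fun t => v c t) d) d :=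
    DifferentiableAt.hasDerivAt <| (hv (c, d)).comp d
      (f := fun t => (c, t)) ((differentiableAt_const c).prodMk differentiableAt_id)
  have h₁ := (((hg (sphH a b c d)).hasDerivAt.comp c (hasDerivAt_sphH_θy a b c d)).fun_mul
    (hasDerivAt_sphHDir_θy (hθ hv₁) (hθ hv₂) a b d)).deriv
  have h₂ := (((hg (sphH a b c d)).hasDerivAt.comp d (hasDerivAt_sphH_φy a b c d)).fun_mul
    (hasDerivAt_sphHDir_φy (hφ hv₁) (hφ hv₂) a b c)).deriv
  simp only [Function.comp_def] at h₁ h₂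
  simp only [Vy, pθy, pφy, h₁, h₂]
  simp only [sphHDir, sphHDirTwo]
  ring

lemma sphH_self (θ φ : ℝ) : sphH θ φ θ φ = 1 := by
  simp [sphH, ← sq]

lemma sphHDir_self (p q θ φ : ℝ) : sphHDir p q θ φ θ φ = 0 := by
  simp [sphHDir, mul_comm]

lemma hasDerivAt_sphHDirTwo_θx_self (p q r s θ φ : ℝ) :
    HasDerivAt (fun t => sphHDirTwo p q r s t φ θ φ)
      (r * sin φ ^ 2 + 2 * p * q * (sin φ * cos φ)) θ := by
  unfold sphHDirTwo
  have h := (hasDerivAt_id θ).sub_const θ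
  refine ((((hasDerivAt_sphHDir_θx r s θ φ θ φ).sub
    ((h.cos.const_mul (sin φ * sin φ)).const_mul (p ^ 2))).add
    ((h.sin.const_mul (sin φ * cos φ)).const_mul (2 * p * q))).sub
    ((hasDerivAt_sphH_θx θ φ θ φ).const_mul (q ^ 2))).congr_deriv ?_
  simp only [id, sub_self, sin_zero, cos_zero]
  ring

lemma hasDerivAt_sphHDirTwo_φx_self (p q r s θ φ : ℝ) :
    HasDerivAt (fun t => sphHDirTwo p q r s θ t θ φ) (s - p ^ 2 * (sin φ * cos φ)) φ := by
  unfold sphHDirTwo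
  refine ((((hasDerivAt_sphHDir_φx r s θ φ θ φ).sub
    ((((hasDerivAt_sin φ).mul_const _).mul_const _).const_mul (p ^ 2))).add
    ((((hasDerivAt_sin φ).mul_const _).mul_const _).const_mul (2 * p * q))).sub
    ((hasDerivAt_sphH_φx θ φ θ φ).const_mul (q ^ 2))).congr_deriv ?_
  simp only [sub_self, sin_zero, cos_zero]
  linear_combination s * sin_sq_add_cos_sq φ

lemma deriv_sq_comp_add_mul_comp {g k H A B : ℝ → ℝ} {x H' A' B' : ℝ}
    (hg : DifferentiableAt ℝ g (H x)) (hk : DifferentiableAt ℝ k (H x))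
    (hH : HasDerivAt H H' x) (hA : HasDerivAt A A' x) (hB : HasDerivAt B B' x)
    (hH' : H' = 0) (hA₀ : A x = 0) :
    deriv (fun t => k (H t) * A t ^ 2 + g (H t) * B t) x = g (H x) * B' := by
  have h := (((hk.hasDerivAt.comp x hH).fun_mul (hA.fun_pow 2)).fun_add
    ((hg.hasDerivAt.comp x hH).fun_mul hB)).deriv
  simp only [Function.comp_def] at h
  rw [h, hH', hA₀]
  ring

/-- `V_x^⊥ V_y V_y P_l(h)` on the diagonal equals `ã₃₄(θ,φ) P_l'(1)`. -/
theorem VxperpVyVy_on_diagonal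
    (v₁ v₂ : ℝ → ℝ → ℝ)
    (hv₁ : ContDiff ℝ (⊤ : ℕ∞) (Function.uncurry v₁)) (hv₂ : ContDiff ℝ (⊤ : ℕ∞) (Function.uncurry v₂))
    (l : ℕ) (θ φ : ℝ) (hφ : φ ∈ Set.Ioo 0 π) :
    Vxp v₁ v₂ (Vy v₁ v₂ (Vy v₁ v₂ (PH l))) θ φ θ φ =
      (v₂ θ φ * v₁ θ φ * deriv (fun t => v₁ t φ) θ * (Real.sin φ) ^ 2 +
        2 * (v₂ θ φ) ^ 2 * v₁ θ φ * Real.sin φ * Real.cos φ +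
        (v₂ θ φ) ^ 2 * deriv (fun t => v₁ θ t) φ * (Real.sin φ) ^ 2 +
        (v₁ θ φ) ^ 3 * Real.cos φ * (Real.sin φ) ^ 3 -
        (v₁ θ φ) ^ 2 * deriv (fun t => v₂ t φ) θ * (Real.sin φ) ^ 2 -
        v₁ θ φ * v₂ θ φ * deriv (fun t => v₂ θ t) φ * (Real.sin φ) ^ 2) *
        deriv (legP l) 1 := by
  have hf := contDiff_infty_iff_deriv.1 (contDiff_legP l)
  have hg := contDiff_infty_iff_deriv.1 hf.2
  have hk := contDiff_infty_iff_deriv.1 hg.2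
  have hPH : PH l = fun a b c d => legP l (sphH a b c d) := rfl
  rw [hPH, Vy_comp_sphH v₁ v₂ hf.1,
    Vy_mul_sphHDir (hv₁.differentiable (by simp)) (hv₂.differentiable (by simp)) hg.1]
  simp only [Vxp, pθx, pφx]
  rw [deriv_sq_comp_add_mul_comp (hg.1 _) (hk.1 _) (hasDerivAt_sphH_θx θ φ θ φ)
      (hasDerivAt_sphHDir_θx _ _ θ φ θ φ) (hasDerivAt_sphHDirTwo_θx_self _ _ _ _ θ φ)
      (by simp) (sphHDir_self _ _ θ φ),
    deriv_sq_comp_add_mul_comp (hg.1 _) (hk.1 _) (hasDerivAt_sphH_φx θ φ θ φ)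
      (hasDerivAt_sphHDir_φx _ _ θ φ θ φ) (hasDerivAt_sphHDirTwo_φx_self _ _ _ _ θ φ)
      (by simp [mul_comm]) (sphHDir_self _ _ θ φ), sphH_self]
  ring
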